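/- For every graph G there is no duality gap between the primal and dual semidefinite programs associated with Boppana's optimization: p(G) = d(G), where p(G) = inf { n·z − 𝟙ᵀd : z ∈ ℝ, d ∈ ℝ^n, z·I − P·(A + diag(d))·P positive semidefinite } and d(G) = sup { (P·A·P) • Y : Y ∈ ℝ^{n×n} symmetric positive semidefinite, tr(Y) = n, and (P·Y·P)_{ii} = 1 for every i }. Moreover, the primal infimum is attained: there exists a feasible pair (z,d) with n·z − 𝟙ᵀd = p(G). -/

import Mathlib

open Matrix BigOperators Finset

noncomputable section

/-- Adjacency matrix of a graph on `Fin n`, with real entries. -/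
def adjA {n : ℕ} (G : SimpleGraph (Fin n)) [DecidableRel G.Adj] :
    Matrix (Fin n) (Fin n) ℝ :=
  Matrix.of fun i j => if G.Adj i j then (1 : ℝ) else 0

/-- A bisection vector: entries in `{+1, -1}` summing to zero. -/
def IsBisection {n : ℕ} (x : Fin n → ℝ) : Prop :=
  (∀ i, x i = 1 ∨ x i = -1) ∧ ∑ i, x i = 0

/-- Cut width of a `±1` vector: `∑_{{i,j}∈E} (1 - x_i x_j)/2`, written as a sum
over ordered pairs (each edge counted twice, hence the `/4`). -/
def cw {n : ℕ} (G : SimpleGraph (Fin n)) [DecidableRel G.Adj] (x : Fin n → ℝ) : ℝ :=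
  (∑ i, ∑ j, adjA G i j * (1 - x i * x j)) / 4

/-- Bisection width: minimum cut width over all bisection vectors. -/
def bw {n : ℕ} (G : SimpleGraph (Fin n)) [DecidableRel G.Adj] : ℝ :=
  sInf {c | ∃ x : Fin n → ℝ, IsBisection x ∧ cw G x = c}

/-- `λ_S(B)`: supremum of the Rayleigh quotient of `B` over nonzero vectors of
coordinate sum zero. -/
def lamS {n : ℕ} (B : Matrix (Fin n) (Fin n) ℝ) : ℝ :=
  sSup {r | ∃ x : Fin n → ℝ, x ≠ 0 ∧ ∑ i, x i = 0 ∧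
    r = (x ⬝ᵥ B.mulVec x) / (∑ i, (x i) ^ 2)}

/-- Sum of all entries of a matrix. -/
def msum {n : ℕ} (M : Matrix (Fin n) (Fin n) ℝ) : ℝ := ∑ i, ∑ j, M i j

/-- Boppana's function `g(G,d)`. -/
def gB {n : ℕ} (G : SimpleGraph (Fin n)) [DecidableRel G.Adj] (d : Fin n → ℝ) : ℝ :=
  (msum (adjA G + Matrix.diagonal d) - n * lamS (adjA G + Matrix.diagonal d)) / 4

/-- Boppana's lower bound `h(G) = sup_d g(G,d)`. -/
def hB {n : ℕ} (G : SimpleGraph (Fin n)) [DecidableRel G.Adj] : ℝ :=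
  sSup {r | ∃ d : Fin n → ℝ, r = gB G d}

/-- Number of edges of `G`. -/
def edgeCount {n : ℕ} (G : SimpleGraph (Fin n)) [DecidableRel G.Adj] : ℕ :=
  G.edgeFinset.card

/-- The all-ones matrix `J`. -/
def Jmat (n : ℕ) : Matrix (Fin n) (Fin n) ℝ := Matrix.of fun _ _ => (1 : ℝ)

/-- The projection matrix `P = I - J/n`. -/
def Pmat (n : ℕ) : Matrix (Fin n) (Fin n) ℝ := 1 - (n : ℝ)⁻¹ • Jmat n

/-- The primal SDP value `p(G)` for Boppana's optimization. -/
def pSDP {n : ℕ} (G : SimpleGraph (Fin n)) [DecidableRel G.Adj] : ℝ :=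
  sInf {r | ∃ (z : ℝ) (d : Fin n → ℝ),
    (z • (1 : Matrix (Fin n) (Fin n) ℝ)
      - Pmat n * (adjA G + Matrix.diagonal d) * Pmat n).PosSemidef ∧
    r = (n : ℝ) * z - ∑ i, d i}

/-- The dual SDP value `d(G)` for Boppana's optimization. -/
def dSDP {n : ℕ} (G : SimpleGraph (Fin n)) [DecidableRel G.Adj] : ℝ :=
  sSup {r | ∃ Y : Matrix (Fin n) (Fin n) ℝ, Y.PosSemidef ∧
    Y.trace = (n : ℝ) ∧ (∀ i, (Pmat n * Y * Pmat n) i i = 1) ∧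
    r = ∑ i, ∑ j, (Pmat n * adjA G * Pmat n) i j * Y i j}

/-! ### Helper lemmas -/

lemma Pmat_transpose (n : ℕ) : (Pmat n)ᵀ = Pmat n := by
  ext i j; simp [Pmat, Jmat, Matrix.one_apply, eq_comm]

lemma Pmat_conjTranspose (n : ℕ) : (Pmat n)ᴴ = Pmat n := by
  rw [conjTranspose_eq_transpose_of_trivial, Pmat_transpose]

lemma Pmat_mulVec (n : ℕ) (x : Fin n → ℝ) (i : Fin n) :
    (Pmat n *ᵥ x) i = x i - (n : ℝ)⁻¹ * ∑ j, x j := by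
  have : (Jmat n *ᵥ x) i = ∑ j, x j := by simp [Jmat, mulVec, dotProduct]
  rw [Pmat, sub_mulVec, smul_mulVec, one_mulVec]
  simp [this]

lemma Pmat_mulVec_sum {n : ℕ} (hn : 0 < n) (x : Fin n → ℝ) :
    ∑ i, (Pmat n *ᵥ x) i = 0 := by
  have : (n : ℝ) ≠ 0 := by positivity
  simp only [Pmat_mulVec, Finset.sum_sub_distrib, Finset.sum_const, card_univ, Fintype.card_fin,
    nsmul_eq_mul]
  field_simp
  ring

lemma Pmat_mulVec_of_sum {n : ℕ} (x : Fin n → ℝ) (hx : ∑ i, x i = 0) :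
    Pmat n *ᵥ x = x := by
  ext i; simp [Pmat_mulVec, hx]

lemma Pmat_sq {n : ℕ} (hn : 0 < n) : Pmat n * Pmat n = Pmat n := by
  apply Matrix.ext_of_mulVec_single
  intro i
  rw [← mulVec_mulVec, Pmat_mulVec_of_sum _ (Pmat_mulVec_sum hn _)]

lemma adjA_transpose {n : ℕ} (G : SimpleGraph (Fin n)) [DecidableRel G.Adj] :
    (adjA G)ᵀ = adjA G := by
  ext i j; simp [adjA, G.adj_comm]

lemma trace_mul_nonneg' {n : ℕ} {M Y : Matrix (Fin n) (Fin n) ℝ} (hM : M.PosSemidef)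
    (hY : Y.PosSemidef) : 0 ≤ (M * Y).trace := by
  have h1 : ∃ B : Matrix (Fin n) (Fin n) ℝ, Y = Bᴴ * B := by
    open scoped MatrixOrder in
    exact (CStarAlgebra.nonneg_iff_eq_star_mul_self (a := Y)).1 hY.nonneg
  obtain ⟨B, rfl⟩ := h1
  have := (hM.mul_mul_conjTranspose_same B).trace_nonneg
  rwa [← Matrix.mul_assoc, Matrix.trace_mul_comm, ← Matrix.mul_assoc]

lemma sum_eq_trace {n : ℕ} {M Y : Matrix (Fin n) (Fin n) ℝ} (hY : Y.PosSemidef) :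
    ∑ i, ∑ j, M i j * Y i j = (M * Y).trace := by
  have h : Yᵀ = Y := by
    rw [← conjTranspose_eq_transpose_of_trivial]; exact hY.1
  simp only [trace, Matrix.diag, Matrix.mul_apply]
  refine Finset.sum_congr rfl fun i _ => Finset.sum_congr rfl fun j _ => ?_
  conv_lhs => rw [← h]
  rfl

lemma trace_diag_mul {n : ℕ} (d : Fin n → ℝ) (Y : Matrix (Fin n) (Fin n) ℝ) :
    (Matrix.diagonal d * Y).trace = ∑ i, d i * Y i i := by
  simp [trace, Matrix.diagonal_mul]

lemma weak_duality {n : ℕ} (G : SimpleGraph (Fin n)) [DecidableRel G.Adj]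
    (z : ℝ) (d : Fin n → ℝ)
    (h : (z • (1 : Matrix (Fin n) (Fin n) ℝ)
      - Pmat n * (adjA G + Matrix.diagonal d) * Pmat n).PosSemidef)
    (Y : Matrix (Fin n) (Fin n) ℝ) (hY : Y.PosSemidef) (htr : Y.trace = (n : ℝ))
    (hd : ∀ i, (Pmat n * Y * Pmat n) i i = 1) :
    ∑ i, ∑ j, (Pmat n * adjA G * Pmat n) i j * Y i j ≤ (n : ℝ) * z - ∑ i, d i := by
  have h0 := trace_mul_nonneg' h hY
  rw [sum_eq_trace hY]
  have h1 : (Pmat n * Matrix.diagonal d * Pmat n * Y).trace = ∑ i, d i := by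
    have : (Pmat n * Matrix.diagonal d * Pmat n * Y).trace
        = (Matrix.diagonal d * (Pmat n * Y * Pmat n)).trace := by
      rw [Matrix.mul_assoc, Matrix.mul_assoc, Matrix.trace_mul_comm]
      simp only [Matrix.mul_assoc]
    rw [this, trace_diag_mul]
    simp [hd]
  rw [Matrix.mul_add, Matrix.add_mul, Matrix.sub_mul, Matrix.add_mul, trace_sub, trace_add, h1,
    Matrix.smul_mul, Matrix.one_mul, trace_smul, htr, smul_eq_mul] at h0
  linarith

/-- Reduced feasibility. -/
def Feas {n : ℕ} (G : SimpleGraph (Fin n)) [DecidableRel G.Adj] (a : Fin n → ℝ) : Prop :=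
  ∀ x : Fin n → ℝ, ∑ i, x i = 0 → x ⬝ᵥ adjA G *ᵥ x ≤ ∑ i, a i * x i ^ 2

lemma Feas.psd {n : ℕ} (hn : 0 < n) {G : SimpleGraph (Fin n)} [DecidableRel G.Adj]
    {a : Fin n → ℝ} (h : Feas G a) :
    ((0 : ℝ) • (1 : Matrix (Fin n) (Fin n) ℝ)
      - Pmat n * (adjA G + Matrix.diagonal (fun i => - a i)) * Pmat n).PosSemidef := by
  apply PosSemidef.of_dotProduct_mulVec_nonneg
  · rw [IsHermitian, conjTranspose_eq_transpose_of_trivial]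
    simp [Matrix.transpose_mul, Pmat_transpose, adjA_transpose, Matrix.mul_assoc]
  · intro x
    have h1 := h (Pmat n *ᵥ x) (Pmat_mulVec_sum hn x)
    have h2 : star x ⬝ᵥ ((0 : ℝ) • (1 : Matrix (Fin n) (Fin n) ℝ)
      - Pmat n * (adjA G + Matrix.diagonal (fun i => - a i)) * Pmat n) *ᵥ x
      = - ((Pmat n *ᵥ x) ⬝ᵥ (adjA G + Matrix.diagonal (fun i => - a i)) *ᵥ (Pmat n *ᵥ x)) := by
      have : (Pmat n *ᵥ x) = x ᵥ* Pmat n := by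
        conv_rhs => rw [← Pmat_transpose, vecMul_transpose]
      conv_rhs => enter [1, 1]; rw [this]
      rw [← dotProduct_mulVec, mulVec_mulVec, mulVec_mulVec, Matrix.mul_assoc]
      simp [neg_mulVec]
    rw [h2, add_mulVec, dotProduct_add]
    have h3 : (Pmat n *ᵥ x) ⬝ᵥ (Matrix.diagonal (fun i => - a i)) *ᵥ (Pmat n *ᵥ x)
        = - ∑ i, a i * (Pmat n *ᵥ x) i ^ 2 := by
      simp only [dotProduct, mulVec_diagonal]
      rw [← Finset.sum_neg_distrib]
      exact Finset.sum_congr rfl fun i _ => by ring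
    rw [h3]; linarith

lemma adj_bound {n : ℕ} (G : SimpleGraph (Fin n)) [DecidableRel G.Adj] :
    Feas G (fun _ => (n : ℝ)) := by
  intro x _
  have h1 : x ⬝ᵥ adjA G *ᵥ x = ∑ i, ∑ j, adjA G i j * (x i * x j) := by
    simp only [dotProduct, mulVec, Finset.mul_sum]
    exact Finset.sum_congr rfl fun i _ => Finset.sum_congr rfl fun j _ => by ring
  have h2 : ∑ i, (n : ℝ) * x i ^ 2 = ∑ i : Fin n, ∑ j : Fin n, (x i ^ 2 + x j ^ 2) / 2 := by
    simp only [← Finset.sum_div, Finset.sum_add_distrib, Finset.sum_const, card_univ,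
      Fintype.card_fin, nsmul_eq_mul, ← Finset.mul_sum]
    ring
  rw [h1, h2]
  refine Finset.sum_le_sum fun i _ => Finset.sum_le_sum fun j _ => ?_
  by_cases h : G.Adj i j
  · simp only [adjA, of_apply, h, if_true]
    nlinarith [sq_nonneg (x i - x j)]
  · simp only [adjA, of_apply, h, if_false]
    nlinarith [sq_nonneg (x i), sq_nonneg (x j)]

/-- The dual value set. -/
def dualSet {n : ℕ} (G : SimpleGraph (Fin n)) [DecidableRel G.Adj] : Set ℝ :=
  {r | ∃ Y : Matrix (Fin n) (Fin n) ℝ, Y.PosSemidef ∧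
    Y.trace = (n : ℝ) ∧ (∀ i, (Pmat n * Y * Pmat n) i i = 1) ∧
    r = ∑ i, ∑ j, (Pmat n * adjA G * Pmat n) i j * Y i j}

lemma dual_bdd {n : ℕ} (hn : 0 < n) (G : SimpleGraph (Fin n)) [DecidableRel G.Adj] :
    BddAbove (dualSet G) := by
  refine ⟨(n : ℝ) * 0 - ∑ i : Fin n, (fun _ => -(n : ℝ)) i, ?_⟩
  rintro r ⟨Y, hY, h1, h2, rfl⟩
  exact weak_duality G _ _ ((adj_bound G).psd hn) Y hY h1 h2

/-- Reduced dual feasibility gives dual value. -/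
lemma dual_mem {n : ℕ} (G : SimpleGraph (Fin n)) [DecidableRel G.Adj]
    (Y : Matrix (Fin n) (Fin n) ℝ) (hY : Y.PosSemidef) (hP : Pmat n * Y * Pmat n = Y)
    (hd : ∀ i, Y i i = 1) : (adjA G * Y).trace ∈ dualSet G := by
  refine ⟨Y, hY, by simp [trace, hd], by simpa [hP] using hd, ?_⟩
  rw [sum_eq_trace hY]
  have : (Pmat n * adjA G * Pmat n * Y).trace = (adjA G * (Pmat n * Y * Pmat n)).trace := by
    rw [Matrix.mul_assoc, Matrix.mul_assoc, Matrix.trace_mul_comm]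
    simp only [Matrix.mul_assoc]
  rw [this, hP]

/-- A strictly feasible dual point. -/
lemma dual_pt {n : ℕ} (hn : 2 ≤ n) (G : SimpleGraph (Fin n)) [DecidableRel G.Adj] :
    (adjA G * (((n : ℝ) / (n - 1)) • Pmat n)).trace ∈ dualSet G := by
  have hn' : (2 : ℝ) ≤ n := by exact_mod_cast hn
  have hP := Pmat_sq (n := n) (by omega)
  apply dual_mem
  · refine PosSemidef.smul ?_ (div_nonneg (by linarith) (by linarith))
    have := posSemidef_conjTranspose_mul_self (Pmat n)
    rwa [Pmat_conjTranspose, hP] at this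
  · simp [hP]
  · intro i
    have : (n : ℝ) - 1 ≠ 0 := by linarith
    simp [Pmat, Jmat]
    field_simp

lemma final_step {n : ℕ} (hn : 2 ≤ n) (G : SimpleGraph (Fin n)) [DecidableRel G.Adj]
    (a : Fin n → ℝ) (ha : Feas G a) (hle : ∑ i, a i ≤ dSDP G) :
    pSDP G = dSDP G ∧
    ∃ (z : ℝ) (d : Fin n → ℝ),
      (z • (1 : Matrix (Fin n) (Fin n) ℝ)
        - Pmat n * (adjA G + Matrix.diagonal d) * Pmat n).PosSemidef ∧
      (n : ℝ) * z - ∑ i, d i = pSDP G := by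
  have hpsd := ha.psd (by omega)
  have hlow : ∀ r ∈ {r | ∃ (z : ℝ) (d : Fin n → ℝ),
    (z • (1 : Matrix (Fin n) (Fin n) ℝ)
      - Pmat n * (adjA G + Matrix.diagonal d) * Pmat n).PosSemidef ∧
    r = (n : ℝ) * z - ∑ i, d i}, dSDP G ≤ r := by
    rintro r ⟨z, d, h, rfl⟩
    refine csSup_le ⟨_, dual_pt hn G⟩ ?_
    rintro r ⟨Y, hY, h1, h2, rfl⟩
    exact weak_duality G z d h Y hY h1 h2
  have hmem : (∑ i, a i) ∈ {r | ∃ (z : ℝ) (d : Fin n → ℝ),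
    (z • (1 : Matrix (Fin n) (Fin n) ℝ)
      - Pmat n * (adjA G + Matrix.diagonal d) * Pmat n).PosSemidef ∧
    r = (n : ℝ) * z - ∑ i, d i} := ⟨0, _, hpsd, by simp⟩
  have heq : pSDP G = dSDP G := le_antisymm
    ((csInf_le ⟨_, hlow⟩ hmem).trans hle) (le_csInf ⟨_, hmem⟩ hlow)
  refine ⟨heq, 0, _, hpsd, ?_⟩
  rw [heq]
  have := hlow _ hmem
  simp only [Finset.sum_neg_distrib]
  linarith

/-- The compact set of normalized reduced dual matrices. -/
def SY (n : ℕ) : Set (Matrix (Fin n) (Fin n) ℝ) :=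
  {Y | Y.PosSemidef ∧ Pmat n * Y * Pmat n = Y ∧ Y.trace = n}

lemma SY_convex (n : ℕ) : Convex ℝ (SY n) := by
  rintro X ⟨hX, hX1, hX2⟩ Y ⟨hY, hY1, hY2⟩ s t hs ht hst
  refine ⟨(hX.smul hs).add (hY.smul ht), ?_, ?_⟩
  · simp [Matrix.mul_add, Matrix.add_mul, hX1, hY1]
  · simp [hX2, hY2, ← add_mul, hst]

lemma psd_entry {n : ℕ} {Y : Matrix (Fin n) (Fin n) ℝ} (hY : Y.PosSemidef) (i j : Fin n) :
    Y i j ∈ Set.Icc (-Y.trace) Y.trace := by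
  have hs : Y j i = Y i j := by simpa using hY.1.apply i j
  have h1 := hY.dotProduct_mulVec_nonneg (Pi.single i 1 + Pi.single j 1)
  have h2 := hY.dotProduct_mulVec_nonneg (Pi.single i 1 - Pi.single j 1)
  have hi : ∀ i, Y i i ≤ Y.trace := fun i =>
    Finset.single_le_sum (f := fun i => Y i i) (fun k _ => hY.diag_nonneg) (Finset.mem_univ i)
  simp [mulVec_add, mulVec_sub, add_dotProduct, sub_dotProduct] at h1 h2
  constructor <;> linarith [hi i, hi j]

lemma SY_compact (n : ℕ) : IsCompact (SY n) := by
  have hc : IsCompact {Y : Matrix (Fin n) (Fin n) ℝ | ∀ i j, Y i j ∈ Set.Icc (-(n : ℝ)) n} := by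
    have := isCompact_univ_pi (X := fun _ : Fin n => Fin n → ℝ)
      (s := fun _ => Set.univ.pi fun _ => Set.Icc (-(n : ℝ)) n)
      (fun _ => isCompact_univ_pi fun _ => isCompact_Icc)
    have he : {Y : Matrix (Fin n) (Fin n) ℝ | ∀ i j, Y i j ∈ Set.Icc (-(n : ℝ)) n}
        = (Set.univ.pi fun _ : Fin n => Set.univ.pi fun _ : Fin n => Set.Icc (-(n : ℝ)) n :
          Set (Fin n → Fin n → ℝ)) := by
      apply Set.ext
      intro Y
      exact ⟨fun h i _ j _ => h i j, fun h i j => h i trivial j trivial⟩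
    rw [he]
    exact this
  refine hc.of_isClosed_subset ?_ ?_
  · have : SY n = {Y | Yᴴ = Y} ∩ (⋂ x : Fin n → ℝ, {Y | 0 ≤ star x ⬝ᵥ Y *ᵥ x}) ∩
        {Y | Pmat n * Y * Pmat n = Y} ∩ {Y | Y.trace = n} := by
      ext Y
      simp only [SY, posSemidef_iff_dotProduct_mulVec, IsHermitian, Set.mem_ofPred_eq,
        Set.mem_inter_iff, Set.mem_iInter]
      tauto
    rw [this]
    refine (((isClosed_eq ?_ ?_).inter (isClosed_iInter fun x => isClosed_le ?_ ?_)).inter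
      (isClosed_eq ?_ ?_)).inter (isClosed_eq ?_ ?_) <;> fun_prop
  · rintro Y ⟨hY, _, h⟩ i j
    rw [← h]; exact psd_entry hY i j

lemma vec_mem_SY {n : ℕ} (x : Fin n → ℝ) (hx : ∑ i, x i = 0) (hq : 0 < ∑ i, x i ^ 2) :
    ((n : ℝ) / ∑ i, x i ^ 2) • vecMulVec x x ∈ SY n := by
  refine ⟨?_, ?_, ?_⟩
  · have := posSemidef_vecMulVec_self_star x
    rw [star_trivial] at this
    exact this.smul (by positivity)
  · have h1 : Pmat n * vecMulVec x x = vecMulVec x x := by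
      rw [mul_vecMulVec, Pmat_mulVec_of_sum x hx]
    have h2 : vecMulVec x x * Pmat n = vecMulVec x x := by
      rw [vecMulVec_mul, ← Pmat_transpose, vecMul_transpose, Pmat_mulVec_of_sum x hx]
    simp [h1, h2]
  · rw [trace_smul, trace_vecMulVec]
    have : x ⬝ᵥ x = ∑ i, x i ^ 2 := by simp [dotProduct, sq]
    rw [this, smul_eq_mul]; field_simp

/-- The map to diagonal and objective. -/
def Lmap {n : ℕ} (G : SimpleGraph (Fin n)) [DecidableRel G.Adj] :
    Matrix (Fin n) (Fin n) ℝ →ₗ[ℝ] (Fin n → ℝ) × ℝ where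
  toFun Y := (fun i => Y i i, (adjA G * Y).trace)
  map_add' X Y := by ext <;> simp [Matrix.mul_add]
  map_smul' c Y := by ext <;> simp

lemma approx_feas {n : ℕ} (hn : 2 ≤ n) (G : SimpleGraph (Fin n)) [DecidableRel G.Adj]
    (ε : ℝ) (hε : 0 < ε) : ∃ a, Feas G a ∧ ∑ i, a i ≤ dSDP G + ε := by
  have hn0 : (0 : ℝ) < n := by exact_mod_cast (by omega : 0 < n)
  have hcont : Continuous (Lmap G) := by
    change Continuous fun Y : Matrix (Fin n) (Fin n) ℝ =>
      ((fun i => Y i i, (adjA G * Y).trace) : (Fin n → ℝ) × ℝ)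
    fun_prop
  have hsup : ∀ r ∈ dualSet G, r ≤ dSDP G := fun r hr => le_csSup (dual_bdd (by omega) G) hr
  have hp : ((fun _ => 1, dSDP G + ε) : (Fin n → ℝ) × ℝ) ∉ Lmap G '' SY n := by
    rintro ⟨Y, ⟨hY, hP, _⟩, h⟩
    have h1 : ∀ i, Y i i = 1 := fun i => congrFun (congrArg Prod.fst h) i
    have h2 : (adjA G * Y).trace = dSDP G + ε := congrArg Prod.snd h
    have := hsup _ (dual_mem G Y hY hP h1)
    linarith
  obtain ⟨f, u, hfp, hfT⟩ := geometric_hahn_banach_point_closed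
    ((SY_convex n).linear_image (Lmap G)) ((SY_compact n).image hcont).isClosed hp
  set α : Fin n → ℝ := fun i => f (Pi.single i 1, 0) with hα
  set β : ℝ := f (0, 1) with hβ
  have hf : ∀ v r, f (v, r) = ∑ i, α i * v i + β * r := by
    intro v r
    have : ((v, r) : (Fin n → ℝ) × ℝ)
        = ∑ i, v i • ((Pi.single i 1, 0) : (Fin n → ℝ) × ℝ) + r • (0, 1) := by
      ext k
      · simp [Prod.fst_sum, Finset.sum_apply, Pi.single_apply]
      · simp [Prod.snd_sum]
    rw [this, map_add, map_sum]
    simp only [map_smul, smul_eq_mul, hα, hβ]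
    congr 1
    · exact Finset.sum_congr rfl fun i _ => mul_comm _ _
    · ring
  rw [hf] at hfp
  have hT : ∀ Y ∈ SY n, u < ∑ i, α i * Y i i + β * (adjA G * Y).trace := by
    intro Y hY
    have := hfT _ ⟨Y, hY, rfl⟩
    rwa [show Lmap G Y = (fun i => Y i i, (adjA G * Y).trace) from rfl, hf] at this
  have hβneg : β < 0 := by
    have hmem : (((n : ℝ) / (n - 1)) • Pmat n) ∈ SY n ∧
        ∀ i, (((n : ℝ) / (n - 1)) • Pmat n) i i = 1 := by
      have hn' : (2 : ℝ) ≤ n := by exact_mod_cast hn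
      have hP := Pmat_sq (n := n) (by omega)
      have hd : ∀ i, (((n : ℝ) / (n - 1)) • Pmat n) i i = 1 := by
        intro i
        have : (n : ℝ) - 1 ≠ 0 := by linarith
        simp [Pmat, Jmat]
        field_simp
      refine ⟨⟨?_, ?_, ?_⟩, hd⟩
      · refine PosSemidef.smul ?_ (div_nonneg (by linarith) (by linarith))
        have := posSemidef_conjTranspose_mul_self (Pmat n)
        rwa [Pmat_conjTranspose, hP] at this
      · simp [hP]
      · simp only [trace, Matrix.diag, hd]; simp
    have h1 := hT _ hmem.1
    simp only [hmem.2] at h1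
    have h2 := hsup _ (dual_pt hn G)
    set v := (adjA G * (((n : ℝ) / (n - 1)) • Pmat n)).trace
    by_contra hb
    push Not at hb
    nlinarith [mul_le_mul_of_nonneg_left (show v ≤ dSDP G + ε by linarith) hb]
  have hβ' : 0 < -β := by linarith
  refine ⟨fun i => (α i - u / n) / (-β), ?_, ?_⟩
  · intro x hx
    by_cases hq : ∑ i, x i ^ 2 = 0
    · have : x = 0 := by
        ext i
        have := (Finset.sum_eq_zero_iff_of_nonneg (fun i _ => sq_nonneg (x i))).1 hq i
          (Finset.mem_univ i)
        simpa using this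
      subst this; simp
    · have hq' : 0 < ∑ i, x i ^ 2 :=
        lt_of_le_of_ne (Finset.sum_nonneg fun i _ => sq_nonneg _) (Ne.symm hq)
      have h1 := hT _ (vec_mem_SY x hx hq')
      set q := ∑ i, x i ^ 2 with hqd
      have h2 : (adjA G * ((n : ℝ) / q) • vecMulVec x x).trace
          = (n / q) * (x ⬝ᵥ adjA G *ᵥ x) := by
        rw [Matrix.mul_smul, trace_smul, mul_vecMulVec, trace_vecMulVec, dotProduct_comm,
          smul_eq_mul]
      have h3 : ∑ i, α i * (((n : ℝ) / q) • vecMulVec x x) i i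
          = (n / q) * ∑ i, α i * x i ^ 2 := by
        rw [Finset.mul_sum]
        refine Finset.sum_congr rfl fun i _ => ?_
        simp [vecMulVec_apply]; ring
      rw [h2, h3] at h1
      have h4 : ∑ i, (α i - u / n) / (-β) * x i ^ 2
          = (∑ i, α i * x i ^ 2 - u / n * q) / (-β) := by
        rw [hqd, Finset.mul_sum, ← Finset.sum_sub_distrib, Finset.sum_div]
        exact Finset.sum_congr rfl fun i _ => by ring
      rw [h4, le_div_iff₀ hβ']
      have h5 : u * (q / n) < (n / q * ∑ i, α i * x i ^ 2 + β * (n / q * (x ⬝ᵥ adjA G *ᵥ x)))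
          * (q / n) := mul_lt_mul_of_pos_right h1 (by positivity)
      have h6 : (n / q * ∑ i, α i * x i ^ 2 + β * (n / q * (x ⬝ᵥ adjA G *ᵥ x)))
          * (q / n) = ∑ i, α i * x i ^ 2 + β * (x ⬝ᵥ adjA G *ᵥ x) := by
        field_simp
      rw [h6] at h5
      have h7 : u / n * q = u * (q / n) := by ring
      rw [h7]; linarith
  · rw [← Finset.sum_div, div_le_iff₀ hβ', Finset.sum_sub_distrib]
    simp only [Finset.sum_const, card_univ, Fintype.card_fin, nsmul_eq_mul, mul_one] at hfp ⊢
    have : (n : ℝ) * (u / n) = u := by field_simp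
    rw [this]; linarith

lemma feas_pair {n : ℕ} {G : SimpleGraph (Fin n)} [DecidableRel G.Adj]
    {a : Fin n → ℝ} (ha : Feas G a) {i j : Fin n} (hij : i ≠ j) : -2 ≤ a i + a j := by
  have h := ha (Pi.single i 1 - Pi.single j 1) (by simp [Finset.sum_sub_distrib])
  have h1 : ∑ k, a k * ((Pi.single i 1 - Pi.single j 1 : Fin n → ℝ) k) ^ 2 = a i + a j := by
    have : ∀ k, a k * ((Pi.single i 1 - Pi.single j 1 : Fin n → ℝ) k) ^ 2
        = (if k = i then a k else 0) + (if k = j then a k else 0) := by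
      intro k
      by_cases h1 : k = i
      · subst h1; simp [hij]
      · by_cases h2 : k = j
        · subst h2; simp [h1]
        · simp [h1, h2]
    rw [Finset.sum_congr rfl fun k _ => this k, Finset.sum_add_distrib]
    simp
  rw [h1] at h
  simp [mulVec_sub, sub_dotProduct] at h
  have h2 : ∀ i j, adjA G i j ≤ 1 := fun i j => by
    simp only [adjA, of_apply]; split_ifs <;> norm_num
  have h3 : ∀ i, adjA G i i = 0 := fun i => by simp [adjA]
  have := h2 i j
  have := h2 j i
  have := h3 i
  have := h3 j
  linarith

lemma feas_lower {n : ℕ} (hn : 3 ≤ n) {G : SimpleGraph (Fin n)} [DecidableRel G.Adj]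
    {a : Fin n → ℝ} (ha : Feas G a) {C : ℝ} (hC : 0 ≤ C) (hs : ∑ i, a i ≤ C) (i : Fin n) :
    -(C + 2 * n) ≤ a i := by
  have h1 : ∑ j ∈ univ.erase i, (-2 : ℝ) ≤ ∑ j ∈ univ.erase i, (a i + a j) :=
    Finset.sum_le_sum fun j hj => feas_pair ha (Finset.ne_of_mem_erase hj).symm
  have h2 := Finset.add_sum_erase univ a (Finset.mem_univ i)
  rw [Finset.sum_add_distrib] at h1
  simp only [Finset.sum_const, nsmul_eq_mul, Finset.card_erase_of_mem (Finset.mem_univ i),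
    card_univ, Fintype.card_fin] at h1
  rw [Nat.cast_sub (by omega)] at h1
  have hn' : (3 : ℝ) ≤ n := by exact_mod_cast hn
  push_cast at h1
  by_contra hb
  push Not at hb
  nlinarith [mul_pos (show (0 : ℝ) < n - 2 by linarith) (show 0 < -(C + 2 * n) - a i by linarith),
    mul_nonneg (show (0 : ℝ) ≤ n - 3 by linarith) hC]

lemma attained {n : ℕ} (hn : 3 ≤ n) (G : SimpleGraph (Fin n)) [DecidableRel G.Adj] :
    ∃ a, Feas G a ∧ ∑ i, a i ≤ dSDP G := by
  set C := |dSDP G| + 1 with hC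
  have hC0 : 0 ≤ C := by positivity
  have hCd : dSDP G + 1 ≤ C := by linarith [le_abs_self (dSDP G)]
  set F : Set (Fin n → ℝ) := {a | Feas G a ∧ ∑ i, a i ≤ C} with hF
  have hclosed : IsClosed F := by
    have : F = (⋂ x : Fin n → ℝ, ⋂ _ : ∑ i, x i = 0,
        {a | x ⬝ᵥ adjA G *ᵥ x ≤ ∑ i, a i * x i ^ 2}) ∩ {a | ∑ i, a i ≤ C} := by
      ext a; simp [hF, Feas]
    rw [this]
    refine (isClosed_iInter fun x => isClosed_iInter fun _ => isClosed_le ?_ ?_).inter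
      (isClosed_le ?_ ?_) <;> fun_prop
  have hcomp : IsCompact F := by
    refine (isCompact_univ_pi (s := fun _ : Fin n =>
      Set.Icc (-(C + 2 * n)) (C + n * (C + 2 * n))) fun _ => isCompact_Icc).of_isClosed_subset
      hclosed ?_
    rintro a ⟨ha, hs⟩ i _
    refine ⟨feas_lower hn ha hC0 hs i, ?_⟩
    have h2 := Finset.add_sum_erase univ a (Finset.mem_univ i)
    have h1 : ∑ j ∈ univ.erase i, (-(C + 2 * n)) ≤ ∑ j ∈ univ.erase i, a j :=
      Finset.sum_le_sum fun j _ => feas_lower hn ha hC0 hs j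
    simp only [Finset.sum_const, nsmul_eq_mul, Finset.card_erase_of_mem (Finset.mem_univ i),
      card_univ, Fintype.card_fin] at h1
    rw [Nat.cast_sub (by omega)] at h1
    push_cast at h1
    have : (0 : ℝ) ≤ C + 2 * n := by positivity
    nlinarith
  obtain ⟨a1, h1, h1'⟩ := approx_feas (by omega) G 1 one_pos
  obtain ⟨a, haF, hmin⟩ := hcomp.exists_isMinOn ⟨a1, h1, by linarith⟩
    (f := fun a : Fin n → ℝ => ∑ i, a i) (by fun_prop)
  refine ⟨a, haF.1, le_of_forall_pos_le_add fun ε hε => ?_⟩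
  obtain ⟨b, hb, hb'⟩ := approx_feas (by omega) G (min ε 1) (lt_min hε one_pos)
  have := hmin (a := b) ⟨hb, by linarith [min_le_right ε 1]⟩
  simp only [Set.mem_ofPred_eq] at this
  linarith [min_le_left ε 1]

lemma two_case (G : SimpleGraph (Fin 2)) [DecidableRel G.Adj] :
    ∃ a, Feas G a ∧ ∑ i, a i ≤ dSDP G := by
  have h3 : ∀ i, adjA G i i = 0 := fun i => by simp [adjA]
  have h4 : adjA G 1 0 = adjA G 0 1 := by simp [adjA, G.adj_comm]
  refine ⟨fun _ => - adjA G 0 1, ?_, ?_⟩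
  · intro x hx
    simp only [Fin.sum_univ_two] at hx
    simp only [dotProduct, mulVec, Fin.sum_univ_two, h3, h4]
    have : x 1 = - x 0 := by linarith
    rw [this]; apply le_of_eq; ring
  · have h := le_csSup (dual_bdd (by norm_num) G) (dual_pt le_rfl G)
    refine le_trans (le_of_eq ?_) h
    simp [trace, Matrix.mul_apply, Fin.sum_univ_two, h3, h4, Pmat, Jmat]
    ring

/-- no duality gap, `p(G) = d(G)`, and the primal optimum is
attained by some feasible `(z, d)`. -/
theorem no_duality_gap {n : ℕ} (hn2 : 2 ≤ n) (hne : Even n)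
    (G : SimpleGraph (Fin n)) [DecidableRel G.Adj] :
    pSDP G = dSDP G ∧
    ∃ (z : ℝ) (d : Fin n → ℝ),
      (z • (1 : Matrix (Fin n) (Fin n) ℝ)
        - Pmat n * (adjA G + Matrix.diagonal d) * Pmat n).PosSemidef ∧
      (n : ℝ) * z - ∑ i, d i = pSDP G := by
  have key : ∃ a, Feas G a ∧ ∑ i, a i ≤ dSDP G := by
    rcases Nat.lt_or_ge 2 n with h | h
    · exact attained h G
    · obtain rfl : n = 2 := le_antisymm h hn2
      exact two_case G
  obtain ⟨a, ha, hle⟩ := key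
  exact final_step hn2 G a ha hle
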